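/- arXiv:1510.00957 — 5 statements merged into one kernel-verified Lean document; each statement's English description precedes it below -/
import Mathlib

section
/- Let n ≥ 1, let K ⊂ ℝⁿ be a compact set contained in the open ball B_R(0) for some R > 0, and let α ≥ 1. For x ∈ ℝⁿ write d₀(x,K) = inf{|x−y| : y ∈ K}. If ∫_{B_R(0)∖K} d₀(x,K)^{−α} dx < ∞, then the Hausdorff dimension of K is at most n − α. -/
open MeasureTheory Metric Set

open Filter Topology
open scoped ENNReal NNReal

/-- Translating a set `N` times by `v` moves at most `N` times the mass moved by one translation. -/
theorem measure_preimage_sub_nsmul_diff_le {E : Type*} [AddCommGroup E] [MeasurableSpace E]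
    [MeasurableAdd E] (μ : Measure E) [μ.IsAddRightInvariant] (K : Set E) (v : E) (N : ℕ) :
    μ ((fun x => x + -(N • v)) ⁻¹' K \ K) ≤ N * μ ((fun x => x + -v) ⁻¹' K \ K) := by
  induction N with
  | zero => simp
  | succ N ih =>
    have hsub : (fun x => x + -((N + 1) • v)) ⁻¹' K \ K ⊆
        (fun x => x + -v) ⁻¹' ((fun x => x + -(N • v)) ⁻¹' K \ K) ∪
          ((fun x => x + -v) ⁻¹' K \ K) := by
      rintro x ⟨hx, hxK⟩
      by_cases h : x + -v ∈ K
      · exact Or.inr ⟨h, hxK⟩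
      · refine Or.inl ⟨?_, h⟩
        have : x + -v + -(N • v) = x + -((N + 1) • v) := by rw [succ_nsmul]; abel
        simpa [this] using hx
    calc _ ≤ _ := measure_mono hsub
      _ ≤ _ := measure_union_le _ _
      _ ≤ N * μ ((fun x => x + -v) ⁻¹' K \ K) + μ ((fun x => x + -v) ⁻¹' K \ K) := by
        rw [measure_preimage_add_right]; gcongr
      _ = _ := by push_cast; ring

/-- The measure on `U \ K` with density `d(·, K) ^ (-α)`. -/
noncomputable def infDistRpowMeasure {E : Type*} [PseudoMetricSpace E] [MeasurableSpace E]
    (μ : Measure E) (U K : Set E) (α : ℝ) : Measure E :=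
  (μ.restrict (U \ K)).withDensity fun x => ‖infDist x K ^ (-α)‖ₑ

theorem isFiniteMeasure_infDistRpowMeasure {E : Type*} [PseudoMetricSpace E] [MeasurableSpace E]
    {μ : Measure E} {U K : Set E} {α : ℝ}
    (h : IntegrableOn (fun x => infDist x K ^ (-α)) (U \ K) μ) :
    IsFiniteMeasure (infDistRpowMeasure μ U K α) :=
  isFiniteMeasure_withDensity h.2.ne

theorem infDistRpowMeasure_self {E : Type*} [PseudoMetricSpace E] [MeasurableSpace E]
    {μ : Measure E} {U K : Set E} {α : ℝ} (hK : MeasurableSet K) :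
    infDistRpowMeasure μ U K α K = 0 := by
  refine withDensity_absolutelyContinuous _ _ ?_
  rw [Measure.restrict_apply hK, inter_sdiff_self, measure_empty]

theorem ofReal_rpow_mul_le_infDistRpowMeasure {E : Type*} [PseudoMetricSpace E]
    [MeasurableSpace E] {μ : Measure E} {U K s : Set E} {α t : ℝ} (hK : IsClosed K)
    (hne : K.Nonempty) (hα : 0 ≤ α) (ht : 0 < t) (hs : MeasurableSet s) (hsU : s ⊆ U \ K)
    (hst : s ⊆ cthickening t K) :
    ENNReal.ofReal (t ^ (-α)) * μ s ≤ infDistRpowMeasure μ U K α s := by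
  rw [infDistRpowMeasure, withDensity_apply _ hs, Measure.restrict_restrict hs,
    inter_eq_left.2 hsU, ← setLIntegral_const]
  refine setLIntegral_mono' hs fun x hx => ?_
  have hpos : 0 < infDist x K := (hK.notMem_iff_infDist_pos hne).1 (hsU hx).2
  have hle : infDist x K ≤ t := ENNReal.toReal_le_of_le_ofReal ht.le (hst hx)
  rw [Real.enorm_of_nonneg (by positivity)]
  exact ENNReal.ofReal_le_ofReal (Real.rpow_le_rpow_of_nonpos hpos hle (by linarith))

theorem IsCompact.measure_eq_zero_of_integrableOn_infDist_rpow {E : Type*} [NormedAddCommGroup E]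
    [NormedSpace ℝ E] [FiniteDimensional ℝ E] [Nontrivial E] [MeasurableSpace E] [BorelSpace E]
    {μ : Measure E} [μ.IsAddHaarMeasure] {U K : Set E} {α : ℝ} (hα : 1 ≤ α) (hU : IsOpen U)
    (hK : IsCompact K) (hKU : K ⊆ U)
    (hint : IntegrableOn (fun x => infDist x K ^ (-α)) (U \ K) μ) : μ K = 0 := by
  rcases K.eq_empty_or_nonempty with rfl | hne
  · simp
  have : ProperSpace E := FiniteDimensional.proper ℝ E
  have := isFiniteMeasure_infDistRpowMeasure hint
  set ν := infDistRpowMeasure μ U K α with hν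
  obtain ⟨ε, hε, hεU⟩ := hK.exists_cthickening_subset_open hU hKU
  obtain ⟨e, he⟩ := exists_norm_eq E zero_le_one
  obtain ⟨T, hT, hKT⟩ := hK.isBounded.exists_pos_norm_le
  have hshift : (fun x => x + -((3 * T) • e)) ⁻¹' K \ K = (fun x => x + -((3 * T) • e)) ⁻¹' K := by
    refine sdiff_eq_left.2 (Set.disjoint_left.2 fun x hx hxK => ?_)
    have h1 := hKT _ hx
    have h2 := hKT _ hxK
    have h3 : ‖(3 * T) • e‖ = 3 * T := by
      rw [norm_smul, he, mul_one, Real.norm_of_nonneg (by positivity)]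
    have h4 := norm_sub_le x (x + -((3 * T) • e))
    rw [show x - (x + -((3 * T) • e)) = (3 * T) • e by abel, h3] at h4
    linarith
  have hlim : Tendsto (fun N : ℕ => 3 * T / (N : ℝ)) atTop (𝓝 0) :=
    tendsto_const_div_atTop_nhds_zero_nat _
  have hbound : ∀ᶠ N : ℕ in atTop,
      μ K ≤ ENNReal.ofReal (3 * T) * ν (cthickening (3 * T / (N : ℝ)) K) := by
    filter_upwards [eventually_gt_atTop 0, hlim.eventually_le_const hε,
      hlim.eventually_le_const one_pos] with N hN hNε hN1
    have hN' : (0 : ℝ) < N := Nat.cast_pos.2 hN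
    set t : ℝ := 3 * T / N with ht
    have htpos : 0 < t := by positivity
    have hNt : N * t = 3 * T := by rw [ht]; field_simp
    set s : Set E := (fun x => x + -(t • e)) ⁻¹' K \ K with hs
    have hsm : MeasurableSet s := (measurable_add_const _ hK.measurableSet).diff hK.measurableSet
    have hst : s ⊆ cthickening t K := fun x hx => by
      refine mem_cthickening_of_dist_le x _ t K hx.1 ?_
      rw [dist_eq_norm, show x - (x + -(t • e)) = t • e by abel, norm_smul, he, mul_one,
        Real.norm_of_nonneg htpos.le]
    have hsU : s ⊆ U \ K := fun x hx => ⟨hεU (cthickening_mono hNε K (hst hx)), hx.2⟩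
    have hνs := ofReal_rpow_mul_le_infDistRpowMeasure (μ := μ) hK.isClosed hne
      (zero_le_one.trans hα) htpos hsm hsU hst
    have hpow : 1 ≤ t * t ^ (-α) := by
      rw [mul_comm, ← Real.rpow_add_one htpos.ne']
      exact Real.one_le_rpow_of_pos_of_le_one_of_nonpos htpos hN1 (by linarith)
    calc μ K = μ ((fun x => x + -(N • (t • e))) ⁻¹' K \ K) := by
          rw [← Nat.cast_smul_eq_nsmul ℝ, smul_smul, hNt, hshift, measure_preimage_add_right]
      _ ≤ N * μ s := measure_preimage_sub_nsmul_diff_le μ K (t • e) N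
      _ ≤ N * (ENNReal.ofReal (t * t ^ (-α)) * μ s) := by
          gcongr
          exact le_mul_of_one_le_left' (by simpa using hpow)
      _ = ENNReal.ofReal (N * t) * (ENNReal.ofReal (t ^ (-α)) * μ s) := by
          rw [ENNReal.ofReal_mul htpos.le, ENNReal.ofReal_mul hN'.le, ENNReal.ofReal_natCast]
          ring
      _ ≤ _ := by
          rw [hNt]
          gcongr
          exact hνs.trans (measure_mono hst)
  have hzero : Tendsto (fun N : ℕ => ENNReal.ofReal (3 * T) * ν (cthickening (3 * T / (N : ℝ)) K))
      atTop (𝓝 0) := by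
    have h := (tendsto_measure_cthickening_of_isCompact (μ := ν) hK).comp hlim
    rw [hν, infDistRpowMeasure_self hK.measurableSet] at h
    simpa only [mul_zero, Function.comp_def] using
      ENNReal.Tendsto.const_mul h (Or.inr (ENNReal.ofReal_ne_top (r := 3 * T)))
  exact le_zero_iff.1 (ge_of_tendsto hzero hbound)

/-- A set has finite `d`-dimensional Hausdorff measure if some finite measure satisfies
`c * r ^ d ≤ ν (closedBall x r)` for all its points `x` and all small `r`. -/
theorem hausdorffMeasure_ne_top_of_le_measure_closedBall {X : Type*} [MetricSpace X]
    [SecondCountableTopology X] [MeasurableSpace X] [BorelSpace X] (ν : Measure X)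
    [IsFiniteMeasure ν] {K : Set X} {d : ℝ} (hd : 0 ≤ d) {c : ℝ≥0∞} (hc : c ≠ 0) (hc' : c ≠ ∞)
    (h : ∀ᶠ r in 𝓝[>] (0 : ℝ), ∀ x ∈ K, c * ENNReal.ofReal r ^ d ≤ ν (closedBall x r)) :
    μH[d] K ≠ ∞ := by
  have hcover (r : ℝ) : ∃ u ⊆ K, (u.PairwiseDisjoint fun a => closedBall a r) ∧
      ∀ a ∈ K, ∃ b ∈ u, closedBall a r ⊆ closedBall b (5 * r) :=
    Vitali.exists_disjoint_subfamily_covering_enlargement_closedBall K id (fun _ => r) r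
      (fun _ _ => le_rfl) 5 (by norm_num)
  choose u huK hudisj hucov using hcover
  obtain ⟨r, -, hrpos, hrlim⟩ := exists_seq_strictAnti_tendsto (0 : ℝ)
  have hucount (k : ℕ) : Countable (u (r k)) :=
    ((hudisj (r k)).countable_of_nonempty_interior fun x _ =>
      (nonempty_ball.2 (hrpos k)).mono ball_subset_interior_closedBall).to_subtype
  have hdiam (k : ℕ) (x : X) : ediam (closedBall x (5 * r k)) ≤ 10 * ENNReal.ofReal (r k) := by
    rw [← closedEBall_ofReal (by linarith [hrpos k])]
    refine ediam_closedEBall_le.trans_eq ?_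
    rw [ENNReal.ofReal_mul (by norm_num), ← mul_assoc, ENNReal.ofReal_ofNat]
    norm_num
  have hlim : Tendsto (fun k => 10 * ENNReal.ofReal (r k)) atTop (𝓝 0) := by
    simpa using ENNReal.Tendsto.const_mul (ENNReal.tendsto_ofReal hrlim)
      (Or.inr (by norm_num : (10 : ℝ≥0∞) ≠ ∞))
  have hle := Measure.hausdorffMeasure_le_liminf_tsum d K (ι := fun k => u (r k)) _ hlim
    (fun k i => closedBall (i : X) (5 * r k)) (.of_forall fun k i => hdiam k i)
    (.of_forall fun k x hx => by
      obtain ⟨b, hb, hsub⟩ := hucov (r k) x hx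
      exact mem_iUnion.2 ⟨⟨b, hb⟩, hsub (mem_closedBall_self (hrpos k).le)⟩)
  have hev := (tendsto_nhdsWithin_iff.2 ⟨hrlim, .of_forall hrpos⟩).eventually h
  have hsum : ∀ᶠ k in atTop, ∑' i : u (r k), ediam (closedBall (i : X) (5 * r k)) ^ d ≤
      10 ^ d * c⁻¹ * ν univ := by
    filter_upwards [hev] with k hk
    calc ∑' i : u (r k), ediam (closedBall (i : X) (5 * r k)) ^ d
        ≤ ∑' i : u (r k), 10 ^ d * c⁻¹ * ν (closedBall (i : X) (r k)) := by
          refine ENNReal.tsum_le_tsum fun i => ?_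
          calc ediam (closedBall (i : X) (5 * r k)) ^ d
              ≤ (10 * ENNReal.ofReal (r k)) ^ d := by gcongr; exact hdiam k i
            _ = 10 ^ d * c⁻¹ * (c * ENNReal.ofReal (r k) ^ d) := by
              rw [ENNReal.mul_rpow_of_nonneg _ _ hd, mul_assoc, ← mul_assoc c⁻¹,
                ENNReal.inv_mul_cancel hc hc', one_mul]
            _ ≤ _ := by gcongr; exact hk i (huK _ i.2)
      _ = 10 ^ d * c⁻¹ * ∑' i : u (r k), ν (closedBall (i : X) (r k)) := ENNReal.tsum_mul_left
      _ ≤ 10 ^ d * c⁻¹ * ν univ := by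
          gcongr
          exact (tsum_meas_le_meas_iUnion_of_disjoint ν (fun _ => measurableSet_closedBall)
            ((hudisj (r k)).on_injective Subtype.val_injective fun x => x.2)).trans
              (measure_mono (subset_univ _))
  refine ne_top_of_le_ne_top ?_ (hle.trans
    ((liminf_le_liminf hsum).trans_eq (liminf_const (10 ^ d * c⁻¹ * ν univ))))
  exact ENNReal.mul_ne_top (ENNReal.mul_ne_top (ENNReal.rpow_ne_top_of_nonneg hd (by norm_num))
    (ENNReal.inv_ne_top.2 hc)) (measure_ne_top _ _)

/-- If the integral of `d(x,K)^(-α)` over `B_R(0) \ K` is finite for some `α ≥ 1`,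
then the Hausdorff dimension of the compact set `K ⊆ B_R(0)` is at most `n - α`. -/
theorem stmt_0 (n : ℕ) (hn : 1 ≤ n) (R : ℝ) (hR : 0 < R) (α : ℝ) (hα : 1 ≤ α)
    (K : Set (EuclideanSpace ℝ (Fin n))) (hK : IsCompact K) (hKR : K ⊆ ball (0 : EuclideanSpace ℝ (Fin n)) R)
    (hint : IntegrableOn (fun x => Metric.infDist x K ^ (-α))
      (ball (0 : EuclideanSpace ℝ (Fin n)) R \ K) volume) :
    dimH K ≤ ENNReal.ofReal ((n : ℝ) - α) := by
  rcases K.eq_empty_or_nonempty with rfl | hne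
  · simp
  have : NeZero n := ⟨by omega⟩
  have hnull := hK.measure_eq_zero_of_integrableOn_infDist_rpow hα isOpen_ball hKR hint
  have := isFiniteMeasure_infDistRpowMeasure hint
  obtain ⟨ε, hε, hεR⟩ := hK.exists_cthickening_subset_open isOpen_ball hKR
  refine dimH_le_of_hausdorffMeasure_ne_top (d := ((n : ℝ) - α).toNNReal) ?_
  refine hausdorffMeasure_ne_top_of_le_measure_closedBall
    (infDistRpowMeasure volume (ball 0 R) K α) (NNReal.coe_nonneg _)
    (c := volume (ball (0 : EuclideanSpace ℝ (Fin n)) 1))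
    (measure_ball_pos _ _ one_pos).ne' measure_ball_lt_top.ne ?_
  filter_upwards [Ioc_mem_nhdsGT (lt_min hε one_pos)] with r ⟨hr, hrmin⟩ x hx
  obtain ⟨hrε, hr1⟩ := le_min_iff.1 hrmin
  have hsub : closedBall x r ⊆ cthickening r K := closedBall_subset_cthickening hx r
  have hpow : r ^ (((n : ℝ) - α).toNNReal : ℝ) ≤ r ^ (-α) * r ^ n := by
    rw [← Real.rpow_natCast, ← Real.rpow_add hr]
    refine Real.rpow_le_rpow_of_exponent_ge hr hr1 ?_
    rw [Real.coe_toNNReal']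
    exact le_max_of_le_left (by linarith)
  calc volume (ball (0 : EuclideanSpace ℝ (Fin n)) 1) *
        ENNReal.ofReal r ^ (((n : ℝ) - α).toNNReal : ℝ)
      ≤ volume (ball (0 : EuclideanSpace ℝ (Fin n)) 1) * ENNReal.ofReal (r ^ (-α) * r ^ n) := by
        rw [ENNReal.ofReal_rpow_of_pos hr]
        gcongr
    _ = ENNReal.ofReal (r ^ (-α)) * volume (closedBall x r \ K) := by
        rw [measure_sdiff_null hnull, Measure.addHaar_closedBall _ _ hr.le,
          finrank_euclideanSpace_fin, ENNReal.ofReal_mul (by positivity)]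
        ring
    _ ≤ infDistRpowMeasure volume (ball 0 R) K α (closedBall x r \ K) :=
        ofReal_rpow_mul_le_infDistRpowMeasure hK.isClosed hne (zero_le_one.trans hα) hr
          (measurableSet_closedBall.diff hK.measurableSet)
          (sdiff_subset_sdiff_left ((hsub.trans (cthickening_mono hrε K)).trans hεR))
          (sdiff_subset.trans hsub)
    _ ≤ _ := measure_mono sdiff_subset
end

section
/- Let n ≥ 1, let K ⊂ ℝⁿ be a compact set contained in the open ball B_R(0) for some R > 0, and let α ≥ n. For x ∈ ℝⁿ write d₀(x,K) = inf{|x−y| : y ∈ K}. If ∫_{B_R(0)∖K} d₀(x,K)^{−α} dx < ∞, then K = ∅. -/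
open MeasureTheory Metric Set

/-- An integrable function is integrable, with the polar weight, along some (in fact almost every)
ray from the origin. -/
theorem MeasureTheory.Integrable.exists_integrableOn_ray {E F : Type*} [NormedAddCommGroup E]
    [NormedSpace ℝ E] [MeasurableSpace E] [BorelSpace E] [FiniteDimensional ℝ E] [Nontrivial E]
    [NormedAddCommGroup F] [NormedSpace ℝ F]
    {μ : Measure E} [μ.IsAddHaarMeasure] {f : E → F} (hf : Integrable f μ) :
    ∃ v : E, ‖v‖ = 1 ∧
      IntegrableOn (fun r : ℝ ↦ r ^ (Module.finrank ℝ E - 1) • f (r • v)) (Ioi 0) := by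
  have h₁ := (integrableOn_iff_comap_subtypeVal (measurableSet_singleton (0 : E)).compl).1
    hf.integrableOn
  have h₂ := ((μ.measurePreserving_homeomorphUnitSphereProd).integrable_comp_emb
    (g := f ∘ Subtype.val ∘ (homeomorphUnitSphereProd E).symm)
    (Homeomorph.measurableEmbedding _)).1 (by
      simpa only [Function.comp_def, Homeomorph.symm_apply_apply] using h₁)
  have : (ae μ.toSphere).NeBot := ae_neBot.2 μ.toSphere_ne_zero
  obtain ⟨v, hv⟩ := h₂.prod_right_ae.exists
  refine ⟨v, norm_eq_of_mem_sphere v, ?_⟩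
  rw [Measure.volumeIoiPow, integrable_withDensity_iff_integrable_smul' (by fun_prop) (by simp)]
    at hv
  rw [integrableOn_iff_comap_subtypeVal measurableSet_Ioi]
  refine hv.congr (.of_forall ?_)
  rintro ⟨r, hr : 0 < r⟩
  simp (disch := positivity) [ENNReal.toReal_ofReal]

/-- A ray issuing from a point of a compact set has a last point in that set. -/
theorem IsCompact.exists_last_mem_ray {E : Type*} [NormedAddCommGroup E] [NormedSpace ℝ E]
    {K : Set E} (hK : IsCompact K) {x v : E} (hx : x ∈ K) (hv : ‖v‖ = 1) :
    ∃ s : ℝ, 0 ≤ s ∧ x + s • v ∈ K ∧ ∀ r, s < r → x + r • v ∉ K := by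
  have hv₀ : v ≠ 0 := by
    rintro rfl
    simp at hv
  have hemb : Topology.IsClosedEmbedding (fun r : ℝ ↦ x + r • v) :=
    (Homeomorph.addLeft x).isClosedEmbedding.comp (isClosedEmbedding_smul_left hv₀)
  have hc : IsCompact ((fun r : ℝ ↦ x + r • v) ⁻¹' K) := hemb.isCompact_preimage hK
  obtain ⟨s, hs, hmax⟩ := hc.exists_isGreatest ⟨0, by simpa using hx⟩
  exact ⟨s, hmax (by simpa using hx), hs, fun r hr hrK ↦ hr.not_ge (hmax hrK)⟩

/-- If the integral of `d(x,K)^(-α)` over `B_R(0) \ K` is finite for some `α ≥ n`,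
then the compact set `K ⊆ B_R(0)` is empty. -/
theorem stmt_1 (n : ℕ) (hn : 1 ≤ n) (R : ℝ) (hR : 0 < R) (α : ℝ) (hα : (n : ℝ) ≤ α)
    (K : Set (EuclideanSpace ℝ (Fin n))) (hK : IsCompact K) (hKR : K ⊆ ball (0 : EuclideanSpace ℝ (Fin n)) R)
    (hint : IntegrableOn (fun x => Metric.infDist x K ^ (-α))
      (ball (0 : EuclideanSpace ℝ (Fin n)) R \ K) volume) :
    K = ∅ := by
  by_contra hne
  obtain ⟨x, hx⟩ := nonempty_iff_ne_empty.2 hne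
  have : NeZero n := ⟨by omega⟩
  have hU : MeasurableSet (ball (0 : EuclideanSpace ℝ (Fin n)) R \ K) :=
    measurableSet_ball.diff hK.measurableSet
  obtain ⟨v, hv, hray⟩ :=
    (((integrable_indicator_iff hU).2 hint).comp_add_left x).exists_integrableOn_ray
  rw [finrank_euclideanSpace_fin] at hray
  obtain ⟨s, hs₀, hsK, hs⟩ := hK.exists_last_mem_ray hx hv
  obtain ⟨ε, hε, hball⟩ := Metric.isOpen_iff.1 isOpen_ball _ (hKR hsK)
  set δ := min ε 1
  have hδ : 0 < δ := lt_min hε one_pos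
  have hsub : Ioc s (s + δ / 2) ⊆ Ioi 0 := fun r hr ↦ hs₀.trans_lt hr.1
  have hbad : IntegrableOn (fun r : ℝ ↦ (r - s)⁻¹) (Ioc s (s + δ / 2)) := by
    refine (hray.mono_set hsub).mono' (by fun_prop) ?_
    filter_upwards [ae_restrict_mem measurableSet_Ioc] with r hr
    have ht : 0 < r - s := sub_pos.2 hr.1
    have htδ : r - s < δ := by linarith [hr.2]
    have ht₁ : r - s ≤ 1 := (htδ.trans_le (min_le_right _ _)).le
    have hdist : dist (x + r • v) (x + s • v) = r - s := by
      rw [dist_add_left, dist_eq_norm, ← sub_smul, norm_smul, hv, mul_one, Real.norm_of_nonneg ht.le]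
    have hrK : x + r • v ∉ K := hs r hr.1
    have hrU : x + r • v ∈ ball (0 : EuclideanSpace ℝ (Fin n)) R \ K :=
      ⟨hball (by rw [mem_ball, hdist]; exact htδ.trans_le (min_le_left _ _)), hrK⟩
    have hd₀ : 0 < infDist (x + r • v) K := (hK.isClosed.notMem_iff_infDist_pos ⟨x, hx⟩).1 hrK
    have hd : infDist (x + r • v) K ≤ r - s := hdist ▸ infDist_le_dist_of_mem hsK
    rw [indicator_of_mem hrU, smul_eq_mul, Real.norm_of_nonneg (by positivity)]
    have hα₀ : -α ≤ 0 := by linarith [n.cast_nonneg (α := ℝ)]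
    calc (r - s)⁻¹ = (r - s) ^ (n - 1) * (r - s) ^ (-(n : ℝ)) := by
          rw [← Real.rpow_natCast, ← Real.rpow_add ht, Nat.cast_pred (by omega),
            ← Real.rpow_neg_one]
          ring_nf
      _ ≤ (r - s) ^ (n - 1) * (r - s) ^ (-α) := by
          gcongr ?_ * ?_
          exact Real.rpow_le_rpow_of_exponent_ge ht ht₁ (by linarith)
      _ ≤ r ^ (n - 1) * infDist (x + r • v) K ^ (-α) := by
          have hr₀ : 0 ≤ r := hs₀.trans hr.1.le
          gcongr ?_ ^ _ * ?_
          · linarith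
          · exact Real.rpow_le_rpow_of_nonpos hd₀ hd hα₀
  have := intervalIntegrable_sub_inv_iff.1
    ((intervalIntegrable_iff_integrableOn_Ioc_of_le (by linarith)).2 hbad)
  rcases this with h | h
  · linarith
  · exact h left_mem_uIcc
end

section
/- Fix 0 < α < 1 and let Λ ⊂ ℝⁿ be a closed set of Lebesgue measure zero. Let f ∈ L_{2α}(ℝⁿ) be smooth on ℝⁿ ∖ Λ, and let f_ε = f ∗ η_ε be its standard mollification. Then for every x ∈ ℝⁿ ∖ Λ, the integral L_α g(x) = −∫_{ℝⁿ} (g(x+y) + g(x−y) − 2g(x))/|y|^{n+2α} dy converges absolutely for g = f and, for all sufficiently small ε > 0, for g = f_ε, and lim_{ε→0} L_α f_ε(x) = L_α f(x). -/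
open MeasureTheory Metric Set Filter

/-- The standard mollification `f_ε = f ∗ η_ε`, where `η_ε(x) = ε^{-n} η(x/ε)`. -/
noncomputable def mollify {n : ℕ} (η f : EuclideanSpace ℝ (Fin n) → ℝ) (ε : ℝ)
    (x : EuclideanSpace ℝ (Fin n)) : ℝ :=
  ∫ y : EuclideanSpace ℝ (Fin n), f (x - y) * ((ε ^ n)⁻¹ * η (ε⁻¹ • y))

/-- Up to a positive constant, the fractional Laplacian of order `α` written via second
differences: `L_α g (x) = -∫ (g(x+y)+g(x-y)-2g(x))/|y|^{n+2α} dy`. -/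
noncomputable def fracLap (n : ℕ) (α : ℝ) (g : EuclideanSpace ℝ (Fin n) → ℝ)
    (x : EuclideanSpace ℝ (Fin n)) : ℝ :=
  -∫ y : EuclideanSpace ℝ (Fin n),
      (g (x + y) + g (x - y) - 2 * g x) / ‖y‖ ^ ((n : ℝ) + 2 * α)

open Topology

section Averages

variable {E : Type*} [NormedAddCommGroup E] [NormedSpace ℝ E]

/-- The second difference `g (x + y) + g (x - y) - 2 g x`. -/
def secondDiff (g : E → ℝ) (x y : E) : ℝ := g (x + y) + g (x - y) - 2 * g x

lemma norm_smul_lt_of_mem_support {η : E → ℝ} (hsupp : ∀ z, η z ≠ 0 → ‖z‖ < 1) {ε δ : ℝ}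
    (hε : |ε| < δ) {z : E} (hz : η z ≠ 0) : ‖ε • z‖ < δ := by
  rw [norm_smul, Real.norm_eq_abs]
  exact lt_of_le_of_lt (mul_le_of_le_one_right (abs_nonneg _) (hsupp z hz).le) hε

/-- Near a point where `f` is `C²`, it is continuous and bounded, and its second differences are
quadratically small, uniformly in the base point. -/
lemma exists_ball_abs_secondDiff_le {f : E → ℝ} {x : E} (hf : ContDiffAt ℝ 2 f x) :
    ∃ r > 0, ∃ B C : ℝ, 0 ≤ C ∧ (∀ w ∈ ball x (2 * r), ContinuousAt f w ∧ ‖f w‖ ≤ B) ∧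
      ∀ w ∈ ball x r, ∀ y ∈ ball (0 : E) r, |secondDiff f w y| ≤ C * ‖y‖ ^ 2 := by
  obtain ⟨K, t, ht, hK⟩ :=
    ContDiffAt.exists_lipschitzOnWith (hf.fderiv_right (m := 1) (by norm_num))
  have hdiff : ∀ᶠ w in 𝓝 x, DifferentiableAt ℝ f w :=
    (hf.eventually (by simp)).mono fun w hw => hw.differentiableAt (by simp)
  have hbd : ∀ᶠ w in 𝓝 x, ‖f w‖ < ‖f x‖ + 1 :=
    hf.continuousAt.norm.eventually_lt_const (lt_add_one _)
  obtain ⟨δ, hδ, hball⟩ := Metric.eventually_nhds_iff_ball.1 ((hdiff.and hbd).and ht)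
  refine ⟨δ / 2, by positivity, ‖f x‖ + 1, 2 * K, by positivity, ?_, ?_⟩
  · intro w hw
    rw [mul_div_cancel₀ _ two_ne_zero] at hw
    exact ⟨(hball w hw).1.1.continuousAt, (hball w hw).1.2.le⟩
  intro w hw y hy
  rw [mem_ball_iff_norm] at hw
  rw [mem_ball_zero_iff] at hy
  have hmem : ∀ v : E, ‖v‖ ≤ ‖y‖ → w + v ∈ ball x δ ∧ w - v ∈ ball x δ := by
    intro v hv
    rw [mem_ball_iff_norm, mem_ball_iff_norm, add_sub_right_comm, sub_right_comm]
    constructor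
    · linarith [norm_add_le (w - x) v]
    · linarith [norm_sub_le (w - x) v]
  have hderiv : ∀ v ∈ closedBall (0 : E) ‖y‖, HasFDerivWithinAt (secondDiff f w)
      (fderiv ℝ f (w + v) - fderiv ℝ f (w - v)) (closedBall (0 : E) ‖y‖) v := by
    intro v hv
    have hv' := hmem v (mem_closedBall_zero_iff.1 hv)
    have h1 : HasFDerivAt (fun v => f (w + v)) (fderiv ℝ f (w + v)) v :=
      (hball _ hv'.1).1.1.hasFDerivAt.comp v ((hasFDerivAt_id v).const_add w)
    have h2 : HasFDerivAt (fun v => f (w - v)) (-fderiv ℝ f (w - v)) v := by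
      have h := (hball _ hv'.2).1.1.hasFDerivAt.comp v ((hasFDerivAt_id v).const_sub w)
      rwa [ContinuousLinearMap.comp_neg] at h
    rw [sub_eq_add_neg]
    exact ((h1.add h2).sub_const (2 * f w)).hasFDerivWithinAt
  have hbound : ∀ v ∈ closedBall (0 : E) ‖y‖,
      ‖fderiv ℝ f (w + v) - fderiv ℝ f (w - v)‖ ≤ 2 * K * ‖y‖ := by
    intro v hv
    have hv0 := mem_closedBall_zero_iff.1 hv
    have hv' := hmem v hv0
    have h := hK.norm_sub_le (hball _ hv'.1).2 (hball _ hv'.2).2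
    have h2 : ‖w + v - (w - v)‖ ≤ 2 * ‖y‖ := by
      rw [add_sub_sub_cancel]
      linarith [norm_add_le v v]
    calc _ ≤ _ := h
      _ ≤ K * (2 * ‖y‖) := by gcongr
      _ = 2 * K * ‖y‖ := by ring
  have h := Convex.norm_image_sub_le_of_norm_hasFDerivWithin_le hderiv hbound
    (convex_closedBall _ _) (mem_closedBall_self (norm_nonneg y))
    (mem_closedBall_zero_iff.2 le_rfl)
  have h0 : secondDiff f w 0 = 0 := by
    simp only [secondDiff, add_zero, sub_zero]
    ring
  rw [h0, sub_zero, sub_zero, Real.norm_eq_abs] at h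
  linarith

variable [MeasureSpace E]

/-- The mollification of `f` at scale `ε` in rescaled form, `∫ f (x - ε z) η z dz`; unlike
`mollify` it makes sense at `ε = 0`, where it returns `f x` if `η` has integral one. -/
noncomputable def scaledAverage (η f : E → ℝ) (ε : ℝ) (x : E) : ℝ :=
  ∫ z : E, f (x - ε • z) * η z

lemma scaledAverage_zero {η : E → ℝ} (hη : ∫ z, η z = 1) (f : E → ℝ) :
    scaledAverage η f 0 = f := by
  funext x
  simp [scaledAverage, integral_const_mul, hη]

variable [BorelSpace E]

lemma measurable_comp_sub_smul {f : E → ℝ} (hf : Measurable f) (x : E) (ε : ℝ) :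
    Measurable fun z : E => f (x - ε • z) :=
  hf.comp (by fun_prop)

lemma continuousAt_scaledAverage {η f : E → ℝ} (hη : Integrable η)
    (hsupp : ∀ z, η z ≠ 0 → ‖z‖ < 1) (hf : Measurable f) {x : E} (hx : ContinuousAt f x) :
    ContinuousAt (fun ε => scaledAverage η f ε x) 0 := by
  have hbd : ∀ᶠ w in 𝓝 x, ‖f w‖ < ‖f x‖ + 1 :=
    hx.norm.eventually_lt_const (lt_add_one _)
  obtain ⟨δ, hδ, hball⟩ := Metric.eventually_nhds_iff_ball.1 hbd
  refine continuousAt_of_dominated (bound := fun z => (‖f x‖ + 1) * ‖η z‖) ?_ ?_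
    (hη.norm.const_mul _) ?_
  · exact Eventually.of_forall fun ε =>
      (measurable_comp_sub_smul hf x ε).aestronglyMeasurable.mul hη.aestronglyMeasurable
  · filter_upwards [Metric.ball_mem_nhds (0 : ℝ) hδ] with ε hε
    refine Eventually.of_forall fun z => ?_
    rw [norm_mul]
    by_cases hz : η z = 0
    · simp [hz]
    · gcongr
      refine (hball _ ?_).le
      rw [mem_ball_iff_norm, sub_sub_cancel_left, norm_neg]
      exact norm_smul_lt_of_mem_support hsupp (by simpa using hε) hz
  · refine Eventually.of_forall fun z => ContinuousAt.mul ?_ continuousAt_const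
    refine ContinuousAt.comp (g := f) ?_ (by fun_prop)
    simpa using hx

lemma measurable_scaledAverage [SecondCountableTopology E] [SFinite (volume : Measure E)] {η f : E → ℝ} (hη : Measurable η)
    (hf : Measurable f) (ε : ℝ) : Measurable (scaledAverage η f ε) := by
  refine (StronglyMeasurable.integral_prod_right
    (f := fun x z : E => f (x - ε • z) * η z) ?_).measurable
  refine Measurable.stronglyMeasurable ?_
  have : Measurable fun p : E × E => p.1 - ε • p.2 := by fun_prop
  exact (hf.comp this).mul (hη.comp measurable_snd)

/-- Second differences of the averages inherit the quadratic bound. -/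
lemma abs_secondDiff_scaledAverage_le {η f : E → ℝ} (hη : Integrable η)
    (hsupp : ∀ z, η z ≠ 0 → ‖z‖ < 1) (hηnn : ∀ z, 0 ≤ η z) (hηint : ∫ z, η z = 1)
    (hf : Measurable f) {x y : E} {r B C ε : ℝ} (hB : ∀ w ∈ ball x (2 * r), ‖f w‖ ≤ B)
    (hC : ∀ w ∈ ball x r, |secondDiff f w y| ≤ C * ‖y‖ ^ 2)
    (hε : |ε| < r) (hy : ‖y‖ < r) :
    |secondDiff (scaledAverage η f ε) x y| ≤ C * ‖y‖ ^ 2 := by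
  have hint : ∀ v : E, ‖v‖ < r → Integrable fun z => f (x + v - ε • z) * η z := by
    intro v hv
    refine (hη.norm.const_mul B).mono' ((measurable_comp_sub_smul hf _ ε).aestronglyMeasurable.mul
      hη.aestronglyMeasurable) (Eventually.of_forall fun z => ?_)
    rw [norm_mul]
    by_cases hz : η z = 0
    · simp [hz]
    · gcongr
      refine hB _ ?_
      rw [mem_ball_iff_norm, show x + v - ε • z - x = v - ε • z by abel]
      linarith [norm_sub_le v (ε • z), norm_smul_lt_of_mem_support hsupp hε hz]
  have h1 := hint y hy
  have h2 := hint (-y) (by rwa [norm_neg])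
  have h3 := hint 0 (by simpa using (abs_nonneg ε).trans_lt hε)
  rw [← sub_eq_add_neg] at h2
  rw [add_zero] at h3
  have h12 : Integrable fun z => f (x + y - ε • z) * η z + f (x - y - ε • z) * η z := h1.add h2
  have heq : secondDiff (scaledAverage η f ε) x y
      = ∫ z, secondDiff f (x - ε • z) y * η z := by
    simp only [secondDiff, scaledAverage]
    rw [← integral_add h1 h2, ← integral_const_mul, ← integral_sub h12 (h3.const_mul 2)]
    refine integral_congr_ae (Eventually.of_forall fun z => ?_)
    simp only [sub_add_eq_add_sub, sub_right_comm x y]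
    ring
  rw [heq, ← Real.norm_eq_abs]
  calc _ ≤ ∫ z, C * ‖y‖ ^ 2 * η z := by
        refine norm_integral_le_of_norm_le (hη.const_mul _) (Eventually.of_forall fun z => ?_)
        rw [norm_mul, Real.norm_of_nonneg (hηnn z)]
        by_cases hz : η z = 0
        · simp [hz]
        · refine mul_le_mul_of_nonneg_right (hC _ ?_) (hηnn z)
          rw [mem_ball_iff_norm, sub_sub_cancel_left, norm_neg]
          exact norm_smul_lt_of_mem_support hsupp hε hz
    _ = C * ‖y‖ ^ 2 := by rw [integral_const_mul, hηint, mul_one]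

end Averages

section FarWeight

variable {E : Type*} [NormedAddCommGroup E]

/-- The kernel `‖y‖ ^ (-s)`, truncated to a bounded continuous function on the ball of
radius `r`. -/
noncomputable def farWeight (s r : ℝ) (y : E) : ℝ := max ‖y‖ r ^ (-s)

lemma continuous_farWeight (s : ℝ) {r : ℝ} (hr : 0 < r) :
    Continuous (farWeight s r : E → ℝ) :=
  (continuous_norm.max continuous_const).rpow_const fun _ => Or.inl (lt_max_of_lt_right hr).ne'

lemma farWeight_nonneg (s : ℝ) {r : ℝ} (hr : 0 < r) (y : E) : 0 ≤ farWeight s r y :=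
  Real.rpow_nonneg (le_max_of_le_right hr.le) _

lemma farWeight_neg (s r : ℝ) (y : E) : farWeight s r (-y) = farWeight s r y := by
  rw [farWeight, norm_neg, farWeight]

lemma farWeight_sub_le {s r R : ℝ} (hs : 0 ≤ s) (hr : 0 < r) {u w : E} (hw : ‖w‖ ≤ R) :
    farWeight s r (u - w) ≤ ((1 + R + r) / r) ^ s * (1 + ‖u‖) ^ (-s) := by
  have hR : 0 ≤ R := (norm_nonneg w).trans hw
  have hm : 0 < max ‖u - w‖ r := lt_max_of_lt_right hr
  have h1 : 1 + ‖u‖ ≤ (1 + R + r) / r * max ‖u - w‖ r := by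
    rw [div_mul_eq_mul_div, le_div_iff₀ hr]
    have h2 : ‖u‖ ≤ ‖u - w‖ + R := by linarith [norm_sub_norm_le u w]
    nlinarith [le_max_left ‖u - w‖ r, le_max_right ‖u - w‖ r]
  have h2 := Real.rpow_le_rpow (by positivity) h1 hs
  rw [Real.mul_rpow (by positivity) hm.le] at h2
  rw [farWeight, Real.rpow_neg hm.le, Real.rpow_neg (by positivity), ← div_eq_mul_inv,
    le_div_iff₀ (by positivity), inv_mul_le_iff₀ (by positivity)]
  linarith

lemma one_add_rpow_neg_le {s a : ℝ} (hs : 0 ≤ s) (ha : 0 ≤ a) :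
    (1 + a) ^ (-s) ≤ 2 / (1 + a ^ s) := by
  rw [Real.rpow_neg (by positivity), inv_le_comm₀ (by positivity) (by positivity), inv_div,
    div_le_iff₀ two_pos]
  have h1 : a ^ s ≤ (1 + a) ^ s := Real.rpow_le_rpow ha (by linarith) hs
  have h2 : 1 ≤ (1 + a) ^ s := Real.one_le_rpow (by linarith) hs
  linarith

lemma abs_mul_one_div_sub_farWeight_le {s r a c : ℝ} (hs : 0 ≤ s) {y : E}
    (ha : ‖y‖ < r → |a| ≤ c * ‖y‖ ^ 2) :
    ‖a * (1 / ‖y‖ ^ s - farWeight s r y)‖ ≤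
      (ball (0 : E) r).indicator (fun y => c * (‖y‖ ^ 2 / ‖y‖ ^ s)) y := by
  by_cases hy : ‖y‖ < r
  · rw [indicator_of_mem (mem_ball_zero_iff.2 hy), norm_mul, Real.norm_eq_abs]
    rcases eq_or_ne y 0 with rfl | hy0
    · have : a = 0 := by simpa using ha hy
      simp [this]
    have hpos : 0 < ‖y‖ := norm_pos_iff.2 hy0
    have hw : |1 / ‖y‖ ^ s - farWeight s r y| ≤ 1 / ‖y‖ ^ s := by
      rw [farWeight, max_eq_right hy.le, Real.rpow_neg (hpos.trans hy).le, ← one_div, abs_le]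
      have h1 : 1 / r ^ s ≤ 1 / ‖y‖ ^ s :=
        one_div_le_one_div_of_le (by positivity) (Real.rpow_le_rpow hpos.le hy.le hs)
      have h2 : 0 ≤ 1 / r ^ s := one_div_nonneg.2 (Real.rpow_nonneg (hpos.trans hy).le _)
      constructor <;> linarith
    calc |a| * |1 / ‖y‖ ^ s - farWeight s r y| ≤ c * ‖y‖ ^ 2 * (1 / ‖y‖ ^ s) :=
          mul_le_mul (ha hy) hw (abs_nonneg _) ((abs_nonneg _).trans (ha hy))
      _ = c * (‖y‖ ^ 2 / ‖y‖ ^ s) := by ring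
  · rw [indicator_of_notMem (by simpa using hy), farWeight, max_eq_left (not_lt.1 hy),
      Real.rpow_neg (norm_nonneg y), ← one_div, sub_self, mul_zero, norm_zero]

/-- `∫ f (w + y) W y dy` for the truncated kernel `W`. -/
noncomputable def farIntegral [MeasureSpace E] (s r : ℝ) (f : E → ℝ) (w : E) : ℝ :=
  ∫ y : E, f (w + y) * farWeight s r y

lemma norm_mul_farWeight_sub_le {s r R : ℝ} (hs : 0 ≤ s) (hr : 0 < r) (f : E → ℝ) {u w : E}
    (hw : ‖w‖ ≤ R) : ‖f u * farWeight s r (u - w)‖ ≤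
      ((1 + R + r) / r) ^ s * 2 * (|f u| / (1 + ‖u‖ ^ s)) := by
  have hR : 0 ≤ R := (norm_nonneg w).trans hw
  rw [norm_mul, Real.norm_of_nonneg (farWeight_nonneg s hr _), Real.norm_eq_abs]
  calc |f u| * farWeight s r (u - w)
      ≤ |f u| * (((1 + R + r) / r) ^ s * (2 / (1 + ‖u‖ ^ s))) := by
        gcongr
        refine (farWeight_sub_le hs hr hw).trans ?_
        gcongr
        exact one_add_rpow_neg_le hs (norm_nonneg u)
    _ = _ := by ring

variable [MeasureSpace E] [BorelSpace E]

lemma measurable_mul_farWeight_sub {s r : ℝ} (hr : 0 < r) {f : E → ℝ} (hf : Measurable f)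
    (w : E) : Measurable fun u => f u * farWeight s r (u - w) :=
  hf.mul ((continuous_farWeight s hr).measurable.comp (measurable_id.sub_const w))

variable [(volume : Measure E).IsAddHaarMeasure]

lemma integrable_mul_farWeight {s r : ℝ} (hs : 0 ≤ s) (hr : 0 < r) {f : E → ℝ}
    (hf : Measurable f) (hfL : Integrable fun u => |f u| / (1 + ‖u‖ ^ s)) (w : E) :
    Integrable fun y => f (w + y) * farWeight s r y := by
  have h : Integrable fun u => f u * farWeight s r (u - w) :=
    (hfL.const_mul _).mono' (measurable_mul_farWeight_sub hr hf w).aestronglyMeasurable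
      (Eventually.of_forall fun u => norm_mul_farWeight_sub_le hs hr f le_rfl)
  simpa using h.comp_add_left w

lemma continuous_farIntegral {s r : ℝ} (hs : 0 ≤ s) (hr : 0 < r) {f : E → ℝ}
    (hf : Measurable f) (hfL : Integrable fun u => |f u| / (1 + ‖u‖ ^ s)) :
    Continuous (farIntegral s r f) := by
  have heq : farIntegral s r f = fun w => ∫ u, f u * farWeight s r (u - w) := by
    funext w
    rw [← integral_add_left_eq_self (fun u => f u * farWeight s r (u - w)) w]
    simp [farIntegral]
  rw [heq, continuous_iff_continuousAt]
  intro x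
  refine continuousAt_of_dominated
    (Eventually.of_forall fun w => (measurable_mul_farWeight_sub hr hf w).aestronglyMeasurable)
    ?_ (hfL.const_mul (((1 + (‖x‖ + 1) + r) / r) ^ s * 2)) ?_
  · filter_upwards [continuous_norm.continuousAt.eventually_lt_const (lt_add_one ‖x‖)] with w hw
    exact Eventually.of_forall fun u => norm_mul_farWeight_sub_le hs hr f hw.le
  · refine Eventually.of_forall fun u => continuousAt_const.mul ?_
    exact ((continuous_farWeight s hr).comp (continuous_const.sub continuous_id)).continuousAt

variable [NormedSpace ℝ E] [FiniteDimensional ℝ E]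

lemma integrable_farWeight {s r : ℝ}
    (hs : (Module.finrank ℝ E : ℝ) < s) (hr : 0 < r) : Integrable (farWeight s r : E → ℝ) := by
  have hs0 : 0 ≤ s := (Nat.cast_nonneg _).trans hs.le
  refine ((integrable_one_add_norm hs).const_mul (((1 + 0 + r) / r) ^ s)).mono'
    (continuous_farWeight s hr).aestronglyMeasurable (Eventually.of_forall fun u => ?_)
  rw [Real.norm_of_nonneg (farWeight_nonneg s hr u)]
  simpa using farWeight_sub_le (u := u) (w := 0) hs0 hr norm_zero.le

/-- Averaging commutes with integration against the truncated kernel. -/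
lemma integral_scaledAverage_mul_farWeight {η f : E → ℝ} (hη : Continuous η)
    (hηc : HasCompactSupport η) {s r : ℝ} (hs : 0 ≤ s) (hr : 0 < r)
    (hf : Measurable f) (hfL : Integrable fun u => |f u| / (1 + ‖u‖ ^ s)) (ε : ℝ) (x : E) :
    Integrable (fun y => scaledAverage η f ε (x + y) * farWeight s r y) ∧
      farIntegral s r (scaledAverage η f ε) x = scaledAverage η (farIntegral s r f) ε x := by
  set F : E → E → ℝ := fun y z => f (x + y - ε • z) * η z * farWeight s r y with hF
  have hmeas : Measurable (Function.uncurry F) := by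
    have h1 : Measurable fun p : E × E => x + p.1 - ε • p.2 := by fun_prop
    exact ((hf.comp h1).mul (hη.measurable.comp measurable_snd)).mul
      ((continuous_farWeight s hr).measurable.comp measurable_fst)
  have hFeq : ∀ y z, F y z = η z * (f (x - ε • z + y) * farWeight s r y) := by
    intro y z
    rw [hF, sub_add_eq_add_sub]
    ring
  have hint : Integrable (Function.uncurry F) (volume.prod volume) := by
    rw [integrable_prod_iff' hmeas.aestronglyMeasurable]
    constructor
    · refine Eventually.of_forall fun z => ?_
      simp only [Function.uncurry_apply_pair, hFeq]
      exact (integrable_mul_farWeight hs hr hf hfL _).const_mul _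
    · have hcont : Continuous fun z => |η z| * farIntegral s r (fun u => |f u|) (x - ε • z) :=
        hη.abs.mul ((continuous_farIntegral hs hr (f := fun u => |f u|) hf.abs
          (by simpa using hfL)).comp (by fun_prop))
      have hcs : HasCompactSupport
          fun z => |η z| * farIntegral s r (fun u => |f u|) (x - ε • z) :=
        HasCompactSupport.mul_right (f := fun z => |η z|) (hηc.comp_left abs_zero)
      refine (hcont.integrable_of_hasCompactSupport hcs).congr (Eventually.of_forall fun z => ?_)
      simp only [Function.uncurry_apply_pair, hFeq, norm_mul, Real.norm_eq_abs,
        abs_of_nonneg (farWeight_nonneg s hr _), farIntegral, integral_const_mul]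
  have hleft : ∀ y, ∫ z, F y z = scaledAverage η f ε (x + y) * farWeight s r y := fun y => by
    rw [hF, scaledAverage, integral_mul_const]
  constructor
  · refine hint.integral_prod_left.congr (Eventually.of_forall fun y => ?_)
    exact hleft y
  · calc farIntegral s r (scaledAverage η f ε) x = ∫ y, ∫ z, F y z := by
          simp only [hleft, farIntegral]
      _ = ∫ z, ∫ y, F y z := integral_integral_swap hint
      _ = scaledAverage η (farIntegral s r f) ε x := by
          simp only [hFeq, integral_const_mul, scaledAverage, farIntegral, mul_comm]

end FarWeight

section SecondDifferenceIntegral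

variable {E : Type*} [NormedAddCommGroup E] [NormedSpace ℝ E] [MeasureSpace E] [BorelSpace E]
  [FiniteDimensional ℝ E] [(volume : Measure E).IsAddHaarMeasure]

lemma integrableOn_ball_sq_norm_div_rpow {s : ℝ} (hs : s < Module.finrank ℝ E + 2) (r : ℝ) :
    IntegrableOn (fun y : E => ‖y‖ ^ 2 / ‖y‖ ^ s) (ball 0 r) := by
  rcases subsingleton_or_nontrivial E with hE | hE
  · exact (continuous_of_discreteTopology.locallyIntegrable.integrableOn_isCompact
      (isCompact_closedBall (0 : E) r)).mono_set ball_subset_closedBall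
  rcases le_or_gt r 0 with hr | hr
  · simp [ball_eq_empty.2 hr]
  rw [integrableOn_fun_norm_addHaar (E := E) volume (f := fun t => t ^ 2 / t ^ s)]
  have hd : 1 ≤ Module.finrank ℝ E := Module.finrank_pos
  have hexp : -1 < (Module.finrank ℝ E : ℝ) - 1 + 2 - s := by linarith
  refine ((intervalIntegral.integrableOn_Ioo_rpow_iff hr).2 hexp).congr_fun ?_ measurableSet_Ioo
  intro t ht
  simp only [smul_eq_mul]
  rw [Real.rpow_sub ht.1, Real.rpow_add ht.1, ← Nat.cast_one, ← Nat.cast_sub hd,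
    Real.rpow_natCast, Real.rpow_two, mul_div_assoc]

/-- The integrals `∫ (g (x + y) + g (x - y) - 2 g x) / ‖y‖ ^ s dy` converge for all averages `g`
of `f` at small scale, and depend continuously on the scale at zero. -/
theorem integrable_and_continuousAt_integral_secondDiff {η f : E → ℝ} (hη : Continuous η)
    (hηc : HasCompactSupport η) (hsupp : ∀ z, η z ≠ 0 → ‖z‖ < 1) (hηnn : ∀ z, 0 ≤ η z)
    (hηint : ∫ z, η z = 1) {s : ℝ} (hs : (Module.finrank ℝ E : ℝ) < s)
    (hs' : s < Module.finrank ℝ E + 2) (hf : Measurable f)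
    (hfL : Integrable fun u => |f u| / (1 + ‖u‖ ^ s)) {x : E} (hx : ContDiffAt ℝ 2 f x) :
    ∃ r > 0, (∀ ε : ℝ, |ε| < r →
        Integrable fun y => secondDiff (scaledAverage η f ε) x y / ‖y‖ ^ s) ∧
      ContinuousAt (fun ε => ∫ y, secondDiff (scaledAverage η f ε) x y / ‖y‖ ^ s) 0 := by
  obtain ⟨r, hr, B, C, -, hB, hC⟩ := exists_ball_abs_secondDiff_le hx
  have hs0 : 0 ≤ s := (Nat.cast_nonneg _).trans hs.le
  have hηi : Integrable η := hη.integrable_of_hasCompactSupport hηc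
  have hsymm : ∀ (g : E → ℝ) (y : E),
      g (x - y) * farWeight s r y = g (x + -y) * farWeight s r (-y) := fun g y => by
    rw [farWeight_neg, sub_eq_add_neg]
  have hW : Integrable (farWeight s r : E → ℝ) := integrable_farWeight hs hr
  set N : ℝ → E → ℝ := fun ε y =>
    secondDiff (scaledAverage η f ε) x y * (1 / ‖y‖ ^ s - farWeight s r y) with hN
  have hNmeas : ∀ ε, Measurable (N ε) := by
    intro ε
    have h := measurable_scaledAverage hη.measurable hf ε
    have h1 : Measurable (secondDiff (scaledAverage η f ε) x) :=
      ((h.comp (measurable_const_add x)).add (h.comp (measurable_const_sub x))).sub_const _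
    exact h1.mul ((measurable_const.div (measurable_norm.pow_const s)).sub
      (continuous_farWeight s hr).measurable)
  have hNle : ∀ ε, |ε| < r → ∀ y, ‖N ε y‖ ≤
      (ball (0 : E) r).indicator (fun y => C * (‖y‖ ^ 2 / ‖y‖ ^ s)) y := fun ε hε y =>
    abs_mul_one_div_sub_farWeight_le hs0 fun hy =>
      abs_secondDiff_scaledAverage_le hηi hsupp hηnn hηint hf (fun w hw => (hB w hw).2)
        (fun w hw => hC w hw y (mem_ball_zero_iff.2 hy)) hε hy
  have hbdd : Integrable
      ((ball (0 : E) r).indicator fun y => C * (‖y‖ ^ 2 / ‖y‖ ^ s)) :=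
    IntegrableOn.integrable_indicator ((integrableOn_ball_sq_norm_div_rpow hs' r).const_mul C)
      measurableSet_ball
  have hNint : ∀ ε, |ε| < r → Integrable (N ε) := fun ε hε =>
    hbdd.mono' (hNmeas ε).aestronglyMeasurable (Eventually.of_forall (hNle ε hε))
  have hfar := fun ε => integral_scaledAverage_mul_farWeight hη hηc hs0 hr hf hfL ε x
  have hfar' : ∀ ε, Integrable fun y => scaledAverage η f ε (x - y) * farWeight s r y := by
    intro ε
    simp only [hsymm]
    exact (hfar ε).1.comp_neg
  have hadd : ∀ ε, Integrable fun y => scaledAverage η f ε (x + y) * farWeight s r y +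
      scaledAverage η f ε (x - y) * farWeight s r y := fun ε => (hfar ε).1.add (hfar' ε)
  have hsub : ∀ ε, Integrable fun y => scaledAverage η f ε (x + y) * farWeight s r y +
      scaledAverage η f ε (x - y) * farWeight s r y -
        2 * scaledAverage η f ε x * farWeight s r y := fun ε =>
    (hadd ε).sub (hW.const_mul _)
  have hsplit : ∀ ε, (fun y => secondDiff (scaledAverage η f ε) x y / ‖y‖ ^ s) = fun y =>
      N ε y + (scaledAverage η f ε (x + y) * farWeight s r y +
        scaledAverage η f ε (x - y) * farWeight s r y -
          2 * scaledAverage η f ε x * farWeight s r y) := by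
    intro ε
    funext y
    simp only [hN, secondDiff]
    ring
  have hvalue : ∀ ε, |ε| < r → ∫ y, secondDiff (scaledAverage η f ε) x y / ‖y‖ ^ s =
      (∫ y, N ε y) + (scaledAverage η (farIntegral s r f) ε x +
        scaledAverage η (farIntegral s r f) ε x -
          2 * scaledAverage η f ε x * ∫ y : E, farWeight s r y) := by
    intro ε hε
    rw [hsplit, integral_add (hNint ε hε) (hsub ε), integral_sub (hadd ε) (hW.const_mul _),
      integral_add (hfar ε).1 (hfar' ε), integral_const_mul, ← (hfar ε).2]
    simp only [hsymm]
    rw [integral_neg_eq_self (fun y => scaledAverage η f ε (x + y) * farWeight s r y)]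
    rfl
  have hsmall : ∀ᶠ ε : ℝ in 𝓝 0, |ε| < r := by
    filter_upwards [ball_mem_nhds (0 : ℝ) hr] with ε hε
    simpa using hε
  refine ⟨r, hr, fun ε hε => ?_, ?_⟩
  · rw [hsplit]
    exact (hNint ε hε).add (hsub ε)
  · refine ContinuousAt.congr (ContinuousAt.add ?_ ?_) (hsmall.mono fun ε hε => (hvalue ε hε).symm)
    · refine continuousAt_of_dominated
        (Eventually.of_forall fun ε => (hNmeas ε).aestronglyMeasurable)
        (hsmall.mono fun ε hε => Eventually.of_forall (hNle ε hε)) hbdd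
        (Eventually.of_forall fun y => ?_)
      by_cases hy : ‖y‖ < r
      · have hcont : ∀ v : E, ‖v‖ < r →
            ContinuousAt (fun ε => scaledAverage η f ε (x + v)) 0 := fun v hv =>
          continuousAt_scaledAverage hηi hsupp hf
            (hB _ (by rw [mem_ball_iff_norm, add_sub_cancel_left]; linarith)).1
        have h1 := hcont y hy
        have h2 := hcont (-y) (by rwa [norm_neg])
        have h3 := hcont 0 (by simpa using hr)
        rw [← sub_eq_add_neg] at h2
        rw [add_zero] at h3
        exact ((h1.add h2).sub (h3.const_mul 2)).mul_const _
      · have hzero : ∀ ε, N ε y = 0 := fun ε => by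
          simp only [hN, farWeight, max_eq_left (not_lt.1 hy), Real.rpow_neg (norm_nonneg y),
            one_div, sub_self, mul_zero]
        simp only [hzero]
        exact continuousAt_const
    · have h1 := continuousAt_scaledAverage (x := x) hηi hsupp
        (continuous_farIntegral hs0 hr hf hfL).measurable
        (continuous_farIntegral hs0 hr hf hfL).continuousAt
      have h2 := continuousAt_scaledAverage hηi hsupp hf hx.continuousAt
      exact (h1.add h1).sub ((h2.const_mul 2).mul_const _)

end SecondDifferenceIntegral

lemma mollify_eq_scaledAverage {n : ℕ} (η f : EuclideanSpace ℝ (Fin n) → ℝ) {ε : ℝ}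
    (hε : 0 < ε) : mollify η f ε = scaledAverage η f ε := by
  funext x
  have h := Measure.integral_comp_inv_smul volume
    (fun z : EuclideanSpace ℝ (Fin n) => f (x - ε • z) * η z) ε
  have hpow : 0 < ε ^ n := pow_pos hε n
  simp only [smul_inv_smul₀ hε.ne', finrank_euclideanSpace_fin, abs_of_pos hpow,
    smul_eq_mul] at h
  rw [mollify, scaledAverage, ← inv_mul_cancel_left₀ hpow.ne' (∫ z, f (x - ε • z) * η z), ← h,
    ← integral_const_mul]
  refine integral_congr_ae (Eventually.of_forall fun y => ?_)
  ring

/-- For `f ∈ L_{2α}(ℝⁿ)` smooth off a closed null set `Λ`, at every `x ∉ Λ` the second-difference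
integral defining `L_α f(x)` converges absolutely, for all sufficiently small `ε > 0` so does the
one for `f_ε`, and `L_α f_ε(x) → L_α f(x)` as `ε → 0⁺`. -/
theorem stmt_10 (n : ℕ) (α : ℝ) (hα : α ∈ Set.Ioo (0 : ℝ) 1)
    (Λ : Set (EuclideanSpace ℝ (Fin n))) (hΛc : IsClosed Λ) (hΛ0 : volume Λ = 0)
    (η : EuclideanSpace ℝ (Fin n) → ℝ) (hη : ContDiff ℝ (⊤ : ℕ∞) η)
    (hηs : tsupport η ⊆ ball (0 : EuclideanSpace ℝ (Fin n)) 1)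
    (hηnn : ∀ x, 0 ≤ η x) (hηint : (∫ x, η x) = 1)
    (f : EuclideanSpace ℝ (Fin n) → ℝ) (hmeas : Measurable f)
    (hfL : Integrable (fun x => |f x| / (1 + ‖x‖ ^ ((n : ℝ) + 2 * α))) volume)
    (hfs : ContDiffOn ℝ (⊤ : ℕ∞) f Λᶜ) :
    ∀ x ∉ Λ,
      Integrable (fun y : EuclideanSpace ℝ (Fin n) =>
        (f (x + y) + f (x - y) - 2 * f x) / ‖y‖ ^ ((n : ℝ) + 2 * α)) volume ∧
      (∃ ε₀ : ℝ, 0 < ε₀ ∧ ∀ ε : ℝ, 0 < ε → ε < ε₀ →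
        Integrable (fun y : EuclideanSpace ℝ (Fin n) =>
          (mollify η f ε (x + y) + mollify η f ε (x - y) - 2 * mollify η f ε x) /
            ‖y‖ ^ ((n : ℝ) + 2 * α)) volume) ∧
      Tendsto (fun ε : ℝ => fracLap n α (mollify η f ε) x)
        (nhdsWithin 0 (Set.Ioi 0)) (nhds (fracLap n α f x)) := by
  intro x hx
  have hsupp : ∀ z, η z ≠ 0 → ‖z‖ < 1 := fun z hz =>
    mem_ball_zero_iff.1 (hηs (subset_tsupport η hz))
  have hηc : HasCompactSupport η :=
    Metric.isCompact_of_isClosed_isBounded (isClosed_tsupport η) (isBounded_ball.subset hηs)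
  have hfx : ContDiffAt ℝ 2 f x :=
    (hfs.contDiffAt (hΛc.isOpen_compl.mem_nhds hx)).of_le (WithTop.coe_le_coe.2 (le_top : (2 : ℕ∞) ≤ ⊤))
  obtain ⟨r, hr, hint, hcont⟩ := integrable_and_continuousAt_integral_secondDiff hη.continuous hηc
    hsupp hηnn hηint (s := n + 2 * α) (by simpa using hα.1) (by simpa using hα.2) hmeas hfL hfx
  refine ⟨?_, ⟨r, hr, fun ε hε hεr => ?_⟩, ?_⟩
  · have h := hint 0 (by simpa using hr)
    rwa [scaledAverage_zero hηint] at h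
  · rw [mollify_eq_scaledAverage η f hε]
    exact hint ε (by rwa [abs_of_pos hε])
  · have h := hcont.neg.tendsto
    rw [Pi.neg_apply, scaledAverage_zero hηint] at h
    refine (h.mono_left nhdsWithin_le_nhds).congr' ?_
    filter_upwards [self_mem_nhdsWithin] with ε hε
    rw [mollify_eq_scaledAverage η f hε]
    rfl
end

section
/- Fix 0 < α < 1 and τ > 0. Let Λ ⊂ ℝⁿ be a nonempty closed set of Lebesgue measure zero and let f ∈ L_{2α}(ℝⁿ) be smooth and positive on ℝⁿ ∖ Λ with K⁻¹ d₀(y,Λ)^{−q} ≤ f(y) ≤ K d₀(y,Λ)^{−q} for all y ∈ ℝⁿ ∖ Λ, for some constants K > 0, q > 0; assume also f ∈ L^τ_loc(ℝⁿ). Let f_ε = f ∗ η_ε. Fix x ∈ ℝⁿ ∖ Λ, let δ₁ > 0 be such that f(y) > 10³ for every y with d₀(y,Λ) ≤ 10δ₁, and set δ₀ = 10⁻⁶ · min{d₀(x,Λ), δ₁}. Then lim_{ε→0} ∫_{ℝⁿ ∖ (B_{δ₀}(x) ∪ T_{δ₀}(Λ))} |f_ε(y)^τ − f(y)^τ| /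 |x−y|^{n+2α} dy = 0, where T_{δ₀}(Λ) = {y ∈ ℝⁿ : d₀(y,Λ) ≤ δ₀}. -/
open MeasureTheory Metric Set Filter

/-- A mollification at `y` lies between any two bounds for `f` on the ball of radius `ε`
around `y`. -/
theorem mollify_mem_Icc {n : ℕ} {η f : EuclideanSpace ℝ (Fin n) → ℝ}
    (hηs : tsupport η ⊆ ball (0 : EuclideanSpace ℝ (Fin n)) 1)
    (hηnn : ∀ x, 0 ≤ η x) (hηint : (∫ x, η x) = 1) (hmeas : Measurable f)
    {ε : ℝ} (hε : 0 < ε) {y : EuclideanSpace ℝ (Fin n)} {a b : ℝ}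
    (hf : ∀ z ∈ ball y ε, f z ∈ Icc a b) : mollify η f ε y ∈ Icc a b := by
  have hηi : Integrable η := by
    by_contra h
    rw [integral_undef h] at hηint
    exact zero_ne_one hηint
  set k : EuclideanSpace ℝ (Fin n) → ℝ := fun z => (ε ^ n)⁻¹ * η (ε⁻¹ • z) with hk
  have hki : Integrable k := (hηi.comp_smul (inv_ne_zero hε.ne')).const_mul _
  have hk1 : ∫ z, k z = 1 := by
    simp only [hk]
    rw [integral_const_mul, Measure.integral_comp_smul, hηint, finrank_euclideanSpace_fin,
      inv_pow, inv_inv, abs_of_pos (pow_pos hε n), smul_eq_mul, mul_one,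
      inv_mul_cancel₀ (pow_pos hε n).ne']
  have hknn : ∀ z, 0 ≤ k z := fun z => mul_nonneg (inv_nonneg.2 (pow_pos hε n).le) (hηnn _)
  have hk0 : ∀ z, ε ≤ ‖z‖ → k z = 0 := by
    intro z hz
    have : ε⁻¹ • z ∉ tsupport η := by
      intro h
      have h1 := hηs h
      rw [mem_ball_zero_iff, norm_smul, norm_inv, Real.norm_of_nonneg hε.le,
        inv_mul_lt_iff₀ hε, mul_one] at h1
      exact h1.not_ge hz
    simp [hk, image_eq_zero_of_notMem_tsupport this]
  have hmem : ∀ z, ‖z‖ < ε → f (y - z) ∈ Icc a b := fun z hz =>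
    hf _ (by simpa [mem_ball, dist_eq_norm] using hz)
  have hlo : ∀ z, a * k z ≤ f (y - z) * k z := by
    intro z
    rcases lt_or_ge ‖z‖ ε with h | h
    · exact mul_le_mul_of_nonneg_right (hmem z h).1 (hknn z)
    · simp [hk0 z h]
  have hhi : ∀ z, f (y - z) * k z ≤ b * k z := by
    intro z
    rcases lt_or_ge ‖z‖ ε with h | h
    · exact mul_le_mul_of_nonneg_right (hmem z h).2 (hknn z)
    · simp [hk0 z h]
  have hfi : Integrable fun z => f (y - z) * k z := by
    refine integrable_of_le_of_le ?_ (Eventually.of_forall hlo) (Eventually.of_forall hhi)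
      (hki.const_mul a) (hki.const_mul b)
    exact (hmeas.comp (measurable_const.sub measurable_id)).aestronglyMeasurable.mul
      hki.aestronglyMeasurable
  have h1 := integral_mono (hki.const_mul a) hfi hlo
  have h2 := integral_mono hfi (hki.const_mul b) hhi
  rw [integral_const_mul, hk1, mul_one] at h1 h2
  exact ⟨h1, h2⟩

theorem measurable_mollify {n : ℕ} {η f : EuclideanSpace ℝ (Fin n) → ℝ} (hη : Measurable η)
    (hf : Measurable f) (ε : ℝ) : Measurable (mollify η f ε) := by
  have h : Measurable (Function.uncurry fun y z : EuclideanSpace ℝ (Fin n) =>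
      f (y - z) * ((ε ^ n)⁻¹ * η (ε⁻¹ • z))) := by
    unfold Function.uncurry
    fun_prop
  exact h.stronglyMeasurable.integral_prod_right.measurable

/-- Mollifications converge at every point of continuity. -/
theorem tendsto_mollify {n : ℕ} {η f : EuclideanSpace ℝ (Fin n) → ℝ}
    (hηs : tsupport η ⊆ ball (0 : EuclideanSpace ℝ (Fin n)) 1)
    (hηnn : ∀ x, 0 ≤ η x) (hηint : (∫ x, η x) = 1) (hmeas : Measurable f)
    {y : EuclideanSpace ℝ (Fin n)} (hy : ContinuousAt f y) :
    Tendsto (fun ε => mollify η f ε y) (nhdsWithin 0 (Ioi 0)) (nhds (f y)) := by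
  refine (nhds_basis_closedBall.tendsto_right_iff).2 fun e he => ?_
  obtain ⟨r, hr, h⟩ := Metric.mem_nhds_iff.1 (hy (closedBall_mem_nhds (f y) he))
  filter_upwards [Ioo_mem_nhdsGT hr] with ε hε
  rw [Real.closedBall_eq_Icc]
  refine mollify_mem_Icc hηs hηnn hηint hmeas hε.1 fun z hz => ?_
  rw [← Real.closedBall_eq_Icc]
  exact h (ball_subset_ball hε.2.le hz)

/-- The kernel `‖x - y‖ ^ (-r)` is integrable away from `x` when `r` exceeds the dimension. -/
theorem integrableOn_inv_norm_sub_rpow {E : Type*} [NormedAddCommGroup E] [NormedSpace ℝ E]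
    [FiniteDimensional ℝ E] [MeasurableSpace E] [BorelSpace E] (μ : Measure E)
    [μ.IsAddHaarMeasure] {r : ℝ} (hr : (Module.finrank ℝ E : ℝ) < r) (x : E) {δ : ℝ}
    (hδ : 0 < δ) : IntegrableOn (fun y => (‖x - y‖ ^ r)⁻¹) (ball x δ)ᶜ μ := by
  have hr0 : 0 < r := (Nat.cast_nonneg _).trans_lt hr
  have h : Integrable (fun y => ((1 + δ) / δ) ^ r * (1 + ‖x - y‖) ^ (-r)) μ :=
    ((integrable_one_add_norm hr).comp_sub_left x).const_mul _
  refine h.integrableOn.mono'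
    (Measurable.aestronglyMeasurable (by fun_prop)) ?_
  filter_upwards [ae_restrict_mem measurableSet_ball.compl] with y hy
  have hy' : δ ≤ ‖x - y‖ := by
    simpa [mem_ball, dist_eq_norm, norm_sub_rev] using hy
  have hp : 0 < ‖x - y‖ := hδ.trans_le hy'
  rw [Real.norm_of_nonneg (by positivity), Real.rpow_neg (by positivity), ← div_eq_mul_inv,
    ← Real.div_rpow (by positivity) (by positivity), ← Real.inv_rpow hp.le]
  refine Real.rpow_le_rpow (by positivity) ?_ hr0.le
  rw [inv_eq_one_div, div_div, div_le_div_iff₀ hp (by positivity)]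
  nlinarith

/-- Away from the singular set and the point `x`, the weighted integral of `|f_ε^τ - f^τ|`
tends to `0` as `ε → 0⁺`. Here `δ₀ = 10⁻⁶ min{d₀(x,Λ), δ₁}` and
`T_{δ₀}(Λ) = {y : d₀(y,Λ) ≤ δ₀}`. -/
theorem stmt_11 (n : ℕ) (α τ : ℝ) (hα : α ∈ Set.Ioo (0 : ℝ) 1) (hτ : 0 < τ)
    (Λ : Set (EuclideanSpace ℝ (Fin n))) (hΛne : Λ.Nonempty) (hΛc : IsClosed Λ)
    (hΛ0 : volume Λ = 0)
    (η : EuclideanSpace ℝ (Fin n) → ℝ) (hη : ContDiff ℝ (⊤ : ℕ∞) η)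
    (hηs : tsupport η ⊆ ball (0 : EuclideanSpace ℝ (Fin n)) 1)
    (hηnn : ∀ x, 0 ≤ η x) (hηint : (∫ x, η x) = 1)
    (f : EuclideanSpace ℝ (Fin n) → ℝ) (hmeas : Measurable f)
    (hfL : Integrable (fun x => |f x| / (1 + ‖x‖ ^ ((n : ℝ) + 2 * α))) volume)
    (hfs : ContDiffOn ℝ (⊤ : ℕ∞) f Λᶜ) (hfpos : ∀ y ∉ Λ, 0 < f y)
    (K q : ℝ) (hK : 0 < K) (hq : 0 < q)
    (hbound : ∀ y ∉ Λ,
      K⁻¹ * Metric.infDist y Λ ^ (-q) ≤ f y ∧ f y ≤ K * Metric.infDist y Λ ^ (-q))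
    (hloc : ∀ s : Set (EuclideanSpace ℝ (Fin n)), IsCompact s →
      IntegrableOn (fun y => |f y| ^ τ) s volume)
    (x : EuclideanSpace ℝ (Fin n)) (hx : x ∉ Λ)
    (δ₁ : ℝ) (hδ₁ : 0 < δ₁)
    (hδ₁' : ∀ y, Metric.infDist y Λ ≤ 10 * δ₁ → (10 : ℝ) ^ 3 < f y) :
    Tendsto (fun ε : ℝ =>
        ∫⁻ y in (ball x (((10 : ℝ) ^ 6)⁻¹ * min (Metric.infDist x Λ) δ₁) ∪
            {y | Metric.infDist y Λ ≤ ((10 : ℝ) ^ 6)⁻¹ * min (Metric.infDist x Λ) δ₁})ᶜ,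
          ENNReal.ofReal (|mollify η f ε y ^ τ - f y ^ τ| / ‖x - y‖ ^ ((n : ℝ) + 2 * α)))
      (nhdsWithin 0 (Set.Ioi 0)) (nhds 0) := by
  have hd : 0 < Metric.infDist x Λ := (hΛc.notMem_iff_infDist_pos hΛne).1 hx
  set δ : ℝ := ((10 : ℝ) ^ 6)⁻¹ * min (Metric.infDist x Λ) δ₁ with hδ_def
  have hδ : 0 < δ := mul_pos (by norm_num) (lt_min hd hδ₁)
  set S := (ball x δ ∪ {y | Metric.infDist y Λ ≤ δ})ᶜ with hS_def
  have hSm : MeasurableSet S := (measurableSet_ball.union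
    (isClosed_le (continuous_infDist_pt Λ) continuous_const).measurableSet).compl
  have hr : (Module.finrank ℝ (EuclideanSpace ℝ (Fin n)) : ℝ) < (n : ℝ) + 2 * α := by
    rw [finrank_euclideanSpace_fin]
    linarith [hα.1]
  set M : ℝ := K * (δ / 2) ^ (-q) with hM
  have hfar : ∀ y, δ / 2 ≤ Metric.infDist y Λ → f y ∈ Icc 0 M := by
    intro y hy
    have hyΛ : y ∉ Λ := fun h => by
      rw [infDist_zero_of_mem h] at hy
      linarith
    refine ⟨(hfpos y hyΛ).le, (hbound y hyΛ).2.trans ?_⟩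
    exact mul_le_mul_of_nonneg_left
      (Real.rpow_le_rpow_of_nonpos (by positivity) hy (by linarith)) hK.le
  have hSdist : ∀ y ∈ S, δ < Metric.infDist y Λ := fun y hy => by
    simp only [hS_def, mem_compl_iff, mem_union, mem_ofPred_eq, not_or, not_le] at hy
    exact hy.2
  have hmol : ∀ ε ∈ Ioo 0 (δ / 2), ∀ y ∈ S, mollify η f ε y ∈ Icc 0 M := by
    intro ε hε y hy
    refine mollify_mem_Icc hηs hηnn hηint hmeas hε.1 fun z hz => hfar z ?_
    have h1 := infDist_le_infDist_add_dist (s := Λ) (x := y) (y := z)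
    have h2 : dist y z < ε := by rwa [dist_comm]
    linarith [hε.2, hSdist y hy]
  rw [← lintegral_zero (μ := volume.restrict S)]
  refine tendsto_lintegral_filter_of_dominated_convergence
    (fun y => ENNReal.ofReal (M ^ τ * (‖x - y‖ ^ ((n : ℝ) + 2 * α))⁻¹)) ?_ ?_ ?_ ?_
  · refine Eventually.of_forall fun ε => ?_
    have := measurable_mollify hη.continuous.measurable hmeas ε
    fun_prop
  · filter_upwards [Ioo_mem_nhdsGT (half_pos hδ)] with ε hε
    filter_upwards [ae_restrict_mem hSm] with y hy
    refine ENNReal.ofReal_le_ofReal ?_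
    rw [div_eq_mul_inv]
    refine mul_le_mul_of_nonneg_right ?_ (by positivity)
    have h1 := hmol ε hε y hy
    have h2 := hfar y (by linarith [hSdist y hy])
    exact abs_sub_le_of_nonneg_of_le (Real.rpow_nonneg h1.1 _)
      (Real.rpow_le_rpow h1.1 h1.2 hτ.le) (Real.rpow_nonneg h2.1 _)
      (Real.rpow_le_rpow h2.1 h2.2 hτ.le)
  · have hi : IntegrableOn (fun y => M ^ τ * (‖x - y‖ ^ ((n : ℝ) + 2 * α))⁻¹) S :=
      ((integrableOn_inv_norm_sub_rpow volume hr x hδ).mono_set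
        (compl_subset_compl.2 subset_union_left)).const_mul _
    exact hi.lintegral_lt_top.ne
  · filter_upwards [ae_restrict_mem hSm] with y hy
    have hyΛ : y ∉ Λ := fun h => by
      have := hSdist y hy
      rw [infDist_zero_of_mem h] at this
      linarith
    have hcont : ContinuousAt f y :=
      hfs.continuousOn.continuousAt (hΛc.isOpen_compl.mem_nhds hyΛ)
    have h := (((tendsto_mollify hηs hηnn hηint hmeas hcont).rpow_const
      (Or.inr hτ.le) (p := τ)).sub_const (f y ^ τ)).abs.div_const
      (‖x - y‖ ^ ((n : ℝ) + 2 * α))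
    simpa using ENNReal.tendsto_ofReal h
end

section
/- Let Λ ⊂ ℝ³ be a nonempty closed set of Lebesgue measure zero and let w be a smooth real-valued function on ℝ³ ∖ Λ such that f = e^w belongs to L_1(ℝ³) (i.e. ∫_{ℝ³} e^{w(x)}/(1+|x|⁴) dx < ∞), satisfies K⁻¹ d₀(y,Λ)^{−q} ≤ e^{w(y)} ≤ K d₀(y,Λ)^{−q} for all y ∈ ℝ³ ∖ Λ for some constants K > 0, q > 0, and e^w ∈ L^τ_loc(ℝ³) for some τ > 1. Then for every x ∈ ℝ³ ∖ Λ, L_{1/2}(w)(x) ≥ e^{−w(x)} · L_{1/2}(e^w)(x), where L_{1/2} g(x) = −∫_{ℝ³} (g(x+y)+g(x−y)−2g(x))/|y|⁴ dy. -/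
open MeasureTheory Metric Set Filter

/-- Up to a positive constant, the half Laplacian `(-Δ)^{1/2}` on `ℝ³` written via second
differences: `L_{1/2} g (x) = -∫ (g(x+y)+g(x-y)-2g(x))/|y|⁴ dy`. -/
noncomputable def halfLap (g : EuclideanSpace ℝ (Fin 3) → ℝ)
    (x : EuclideanSpace ℝ (Fin 3)) : ℝ :=
  -∫ y : EuclideanSpace ℝ (Fin 3), (g (x + y) + g (x - y) - 2 * g x) / ‖y‖ ^ (4 : ℕ)

lemma ContDiffAt.exists_abs_second_difference_le {E : Type*} [NormedAddCommGroup E]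
    [NormedSpace ℝ E] {g : E → ℝ} {x : E} (hg : ContDiffAt ℝ 2 g x) :
    ∃ δ > 0, ∃ C, ∀ y, ‖y‖ < δ → |g (x + y) + g (x - y) - 2 * g x| ≤ C * ‖y‖ ^ 2 := by
  have hd : ContDiffAt ℝ 1 (fderiv ℝ g) x := hg.fderiv_right (by norm_num)
  obtain ⟨K, t, ht, hK⟩ := hd.exists_lipschitzOnWith
  have hev : ∀ᶠ z in nhds x, DifferentiableAt ℝ g z :=
    (hg.eventually (by simp)).mono fun z hz => hz.differentiableAt (by norm_num)
  obtain ⟨δ, hδ, hball⟩ := Metric.mem_nhds_iff.1 (Filter.inter_mem ht hev)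
  refine ⟨δ, hδ, 2 * K, fun y hy => ?_⟩
  have key := (convex_closedBall (0 : E) ‖y‖).norm_image_sub_le_of_norm_hasFDerivWithin_le
    (f := fun u => g (x + u) + g (x - u)) (f' := fun u => fderiv ℝ g (x + u) - fderiv ℝ g (x - u))
    (C := 2 * K * ‖y‖) (x := 0) (y := y) ?_ ?_ (by simp) (by simp)
  · rw [Real.norm_eq_abs] at key
    simp only [add_zero, sub_zero] at key
    calc _ = |g (x + y) + g (x - y) - (g x + g x)| := by ring_nf
      _ ≤ _ := key
      _ = _ := by ring
  · intro u hu
    have hu' : ‖u‖ < δ := lt_of_le_of_lt (by simpa using hu) hy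
    have h1 : DifferentiableAt ℝ g (x + u) := (hball (by simpa using hu')).2
    have h2 : DifferentiableAt ℝ g (x - u) := (hball (by simpa [dist_eq_norm] using hu')).2
    have e1 : HasFDerivAt (fun u => g (x + u)) (fderiv ℝ g (x + u)) u := by
      simpa [Function.comp_def] using h1.hasFDerivAt.comp u ((hasFDerivAt_id u).const_add x)
    have e2 : HasFDerivAt (fun u => g (x - u)) (-fderiv ℝ g (x - u)) u := by
      simpa [Function.comp_def] using h2.hasFDerivAt.comp u ((hasFDerivAt_id u).const_sub x)
    rw [sub_eq_add_neg]
    exact (e1.add e2).hasFDerivWithinAt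
  · intro u hu
    have hu1 : ‖u‖ ≤ ‖y‖ := by simpa using hu
    have hu' : ‖u‖ < δ := lt_of_le_of_lt hu1 hy
    have h1 := (hball (show x + u ∈ _ by simpa using hu')).1
    have h2 := (hball (show x - u ∈ _ by simpa [dist_eq_norm] using hu')).1
    have h3 := hK.norm_sub_le h1 h2
    have h4 : ‖x + u - (x - u)‖ ≤ 2 * ‖y‖ := by
      have : x + u - (x - u) = (2 : ℝ) • u := by rw [two_smul]; abel
      rw [this, norm_smul]
      simpa using hu1
    calc _ ≤ _ := h3
      _ ≤ K * (2 * ‖y‖) := by gcongr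
      _ = _ := by ring

lemma integrableOn_ball_inv_norm_sq (δ : ℝ) :
    IntegrableOn (fun y : EuclideanSpace ℝ (Fin 3) => (‖y‖ ^ 2)⁻¹) (ball 0 δ) := by
  rw [← integrable_indicator_iff measurableSet_ball]
  have heq : (ball (0 : EuclideanSpace ℝ (Fin 3)) δ).indicator (fun y => (‖y‖ ^ 2)⁻¹) =
      fun y => (Iio δ).indicator (fun r : ℝ => (r ^ 2)⁻¹) ‖y‖ := by
    ext y
    simp [indicator]
  rw [heq, integrable_fun_norm_addHaar volume (f := (Iio δ).indicator fun r : ℝ => (r ^ 2)⁻¹)]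
  have h1 : Integrable ((Ioo 0 δ).indicator fun _ : ℝ => (1 : ℝ)) := by
    rw [integrable_indicator_iff measurableSet_Ioo]
    exact integrableOn_const (by simp)
  refine h1.integrableOn.congr_fun (fun r hr => ?_) measurableSet_Ioi
  have hr0 : (0 : ℝ) < r := hr
  by_cases h : r < δ
  · simp [indicator, hr0, h, hr0.ne']
  · simp [indicator, h]

lemma integrable_sqrt_one_add_norm_div :
    Integrable (fun y : EuclideanSpace ℝ (Fin 3) => √(1 + ‖y‖) / (1 + ‖y‖ ^ 4)) := by
  have h := (integrable_one_add_norm (E := EuclideanSpace ℝ (Fin 3))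
    (μ := volume) (r := 7 / 2)
    (by simp; norm_num)).const_mul 8
  refine h.mono' (Measurable.aestronglyMeasurable (by fun_prop)) (Eventually.of_forall fun y => ?_)
  have hy := norm_nonneg y
  have h4 : (1 + ‖y‖) ^ 4 ≤ 8 * (1 + ‖y‖ ^ 4) := by
    nlinarith [sq_nonneg (‖y‖ - 1), sq_nonneg (‖y‖ ^ 2 - 1), sq_nonneg (‖y‖ ^ 2 - ‖y‖)]
  rw [Real.norm_of_nonneg (by positivity), div_le_iff₀ (by positivity)]
  have h5 : √(1 + ‖y‖) = (1 + ‖y‖) ^ (-(7 / 2) : ℝ) * (1 + ‖y‖) ^ 4 := by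
    rw [Real.sqrt_eq_rpow, ← Real.rpow_natCast, ← Real.rpow_add (by positivity)]
    norm_num
  rw [h5]
  calc _ ≤ (1 + ‖y‖) ^ (-(7 / 2) : ℝ) * (8 * (1 + ‖y‖ ^ 4)) := by gcongr
    _ = _ := by ring

lemma integrable_inv_one_add_norm_pow_four :
    Integrable (fun y : EuclideanSpace ℝ (Fin 3) => (1 + ‖y‖ ^ 4)⁻¹) := by
  refine integrable_sqrt_one_add_norm_div.mono' (by fun_prop) (Eventually.of_forall fun y => ?_)
  rw [Real.norm_of_nonneg (by positivity), inv_eq_one_div]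
  gcongr
  exact Real.one_le_sqrt.2 (by linarith [norm_nonneg y])

/-- The second-difference integrand of `halfLap` converges absolutely for functions in `L_1(ℝ³)`
that are `C²` near the point. -/
lemma integrable_halfLap_integrand {g : EuclideanSpace ℝ (Fin 3) → ℝ} {x : EuclideanSpace ℝ (Fin 3)}
    (hm : Measurable g) (hg : ContDiffAt ℝ 2 g x)
    (hi : Integrable (fun z : EuclideanSpace ℝ (Fin 3) => g z / (1 + ‖z‖ ^ 4))) :
    Integrable (fun y : EuclideanSpace ℝ (Fin 3) =>
      (g (x + y) + g (x - y) - 2 * g x) / ‖y‖ ^ 4) := by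
  have hF : Measurable (fun y => (g (x + y) + g (x - y) - 2 * g x) / ‖y‖ ^ 4) := by
    fun_prop
  obtain ⟨δ, hδ, C, hC⟩ := hg.exists_abs_second_difference_le
  rw [← integrableOn_univ, ← union_compl_self (ball (0 : EuclideanSpace ℝ (Fin 3)) δ)]
  refine IntegrableOn.union ?_ ?_
  · refine ((integrableOn_ball_inv_norm_sq δ).const_mul C).mono' hF.aestronglyMeasurable ?_
    filter_upwards [ae_restrict_mem measurableSet_ball] with y hy
    have hy' : ‖y‖ < δ := by simpa using hy
    rw [norm_div, Real.norm_eq_abs, norm_pow, norm_norm]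
    rcases eq_or_ne y 0 with rfl | h0
    · simp
    · have : 0 < ‖y‖ := norm_pos_iff.2 h0
      rw [div_le_iff₀ (by positivity)]
      refine (hC y hy').trans (le_of_eq ?_)
      field_simp
  · set M : ℝ := (1 + ‖x‖) / δ + 1 with hM
    have h1 := (hi.norm.comp_add_left x)
    have h2 := (hi.norm.comp_sub_left x)
    have h3 := integrable_inv_one_add_norm_pow_four.const_mul (2 * |g x|)
    refine (((h1.add h2).add h3).const_mul (M ^ 4)).integrableOn.mono'
      hF.aestronglyMeasurable ?_
    filter_upwards [ae_restrict_mem measurableSet_ball.compl] with y hy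
    have hy' : δ ≤ ‖y‖ := by simpa using hy
    have hy0 : 0 < ‖y‖ := hδ.trans_le hy'
    have hMy : 1 + ‖x‖ + ‖y‖ ≤ M * ‖y‖ := by
      have : (1 + ‖x‖) / δ * δ ≤ (1 + ‖x‖) / δ * ‖y‖ := by gcongr
      rw [div_mul_cancel₀ _ hδ.ne'] at this
      rw [hM]; linarith
    have main : ∀ (z : EuclideanSpace ℝ (Fin 3)) (a : ℝ), ‖z‖ ≤ ‖x‖ + ‖y‖ →
        |a| / ‖y‖ ^ 4 ≤ M ^ 4 * (|a| / (1 + ‖z‖ ^ 4)) := by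
      intro z a hz
      have hz0 := norm_nonneg z
      have e1 : 1 + ‖z‖ ^ 4 ≤ (1 + ‖z‖) ^ 4 := by
        have : 0 ≤ 4 * ‖z‖ + 6 * ‖z‖ ^ 2 + 4 * ‖z‖ ^ 3 := by positivity
        nlinarith
      have e2 : (1 + ‖z‖) ^ 4 ≤ (M * ‖y‖) ^ 4 := by
        gcongr; linarith
      rw [← mul_div_assoc, div_le_div_iff₀ (by positivity) (by positivity)]
      calc |a| * (1 + ‖z‖ ^ 4) ≤ |a| * (M * ‖y‖) ^ 4 := by gcongr; exact e1.trans e2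
        _ = _ := by ring
    have m1 := main (x + y) (g (x + y)) (norm_add_le _ _)
    have m2 := main (x - y) (g (x - y)) (norm_sub_le _ _)
    have m3 := main y (2 * g x) (by linarith [norm_nonneg x])
    have tri : |g (x + y) + g (x - y) - 2 * g x| ≤ |g (x + y)| + |g (x - y)| + |2 * g x| :=
      (abs_sub _ _).trans (by gcongr; exact abs_add_le _ _)
    rw [norm_div, Real.norm_eq_abs, norm_pow, norm_norm]
    have hn : ∀ z, ‖g z / (1 + ‖z‖ ^ 4)‖ = |g z| / (1 + ‖z‖ ^ 4) := fun z => by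
      rw [norm_div, Real.norm_eq_abs, Real.norm_of_nonneg (by positivity)]
    simp only [Pi.add_apply, hn]
    rw [abs_mul, abs_two] at m3 tri
    calc _ ≤ (|g (x + y)| + |g (x - y)| + 2 * |g x|) / ‖y‖ ^ 4 := by gcongr
      _ = |g (x + y)| / ‖y‖ ^ 4 + |g (x - y)| / ‖y‖ ^ 4 + 2 * |g x| / ‖y‖ ^ 4 := by ring
      _ ≤ _ := add_le_add (add_le_add m1 m2) m3
      _ = _ := by ring

/-- A lower bound of `e^w` by a negative power of the distance to `Λ` forces `w` to decrease at
most logarithmically, so that `w` lies in `L_1(ℝ³)` as soon as `e^w` does. -/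
lemma integrable_div_of_integrable_exp_div {Λ : Set (EuclideanSpace ℝ (Fin 3))} (hΛne : Λ.Nonempty)
    (hΛc : IsClosed Λ) (hΛ0 : volume Λ = 0)
    {w : EuclideanSpace ℝ (Fin 3) → ℝ} (hmeas : Measurable w)
    (hwL : Integrable (fun x : EuclideanSpace ℝ (Fin 3) => Real.exp (w x) / (1 + ‖x‖ ^ 4)))
    {K q : ℝ} (hK : 0 < K) (hq : 0 < q)
    (hbound : ∀ y ∉ Λ, K⁻¹ * infDist y Λ ^ (-q) ≤ Real.exp (w y)) :
    Integrable (fun x : EuclideanSpace ℝ (Fin 3) => w x / (1 + ‖x‖ ^ 4)) := by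
  obtain ⟨p, hp⟩ := hΛne
  set C : ℝ := |Real.log K| + q * (2 * √(1 + ‖p‖)) with hCdef
  refine (hwL.add (integrable_sqrt_one_add_norm_div.const_mul C)).mono'
    (Measurable.aestronglyMeasurable (by fun_prop)) ?_
  have hae : ∀ᵐ z : EuclideanSpace ℝ (Fin 3), z ∉ Λ := measure_eq_zero_iff_ae_notMem.1 hΛ0
  filter_upwards [hae] with z hz
  have hd : 0 < infDist z Λ := (hΛc.notMem_iff_infDist_pos ⟨p, hp⟩).1 hz
  have hz0 := norm_nonneg z
  have hp0 := norm_nonneg p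
  have hlow : -Real.log K - q * Real.log (infDist z Λ) ≤ w z := by
    have := Real.log_le_log (by positivity) (hbound z hz)
    rw [Real.log_exp, Real.log_mul (by positivity) (by positivity), Real.log_inv,
      Real.log_rpow hd] at this
    linarith
  have hdle : infDist z Λ ≤ (1 + ‖p‖) * (1 + ‖z‖) := by
    have h1 : infDist z Λ ≤ ‖z‖ + ‖p‖ :=
      (infDist_le_dist_of_mem hp).trans (by rw [dist_eq_norm]; exact norm_sub_le _ _)
    nlinarith
  have hlog : Real.log (infDist z Λ) ≤ 2 * (√(1 + ‖p‖) * √(1 + ‖z‖)) := by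
    rw [← Real.sqrt_mul (by positivity)]
    refine (Real.log_le_log hd hdle).trans ?_
    have h1 := Real.log_le_sub_one_of_pos
      (Real.sqrt_pos.2 (show 0 < (1 + ‖p‖) * (1 + ‖z‖) by positivity))
    rw [Real.log_sqrt (by positivity)] at h1
    linarith
  have hs1 : 1 ≤ √(1 + ‖z‖) := Real.one_le_sqrt.2 (by linarith)
  have hCnn : 0 ≤ C := by positivity
  have habs : |w z| ≤ Real.exp (w z) + C * √(1 + ‖z‖) := by
    rw [abs_le]
    constructor
    · have h1 : |Real.log K| * 1 ≤ |Real.log K| * √(1 + ‖z‖) := by gcongr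
      have h2 := le_abs_self (Real.log K)
      have h3 := mul_le_mul_of_nonneg_left hlog hq.le
      have h4 := Real.exp_pos (w z)
      rw [hCdef]
      nlinarith
    · have h1 := Real.add_one_le_exp (w z)
      have : 0 ≤ C * √(1 + ‖z‖) := by positivity
      linarith
  rw [norm_div, Real.norm_eq_abs, Real.norm_of_nonneg (show 0 ≤ 1 + ‖z‖ ^ 4 by positivity)]
  calc _ ≤ (Real.exp (w z) + C * √(1 + ‖z‖)) / (1 + ‖z‖ ^ 4) := by gcongr
    _ = _ := by simp only [Pi.add_apply]; ring

/-- If `w` is smooth on `ℝ³ ∖ Λ` (`Λ` a nonempty closed null set), `e^w ∈ L_1(ℝ³)`,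
`e^w` is comparable to `d₀(·,Λ)^{-q}` off `Λ`, and `e^w ∈ L^τ_loc(ℝ³)` for some `τ > 1`, then
`L_{1/2}(w)(x) ≥ e^{-w(x)} L_{1/2}(e^w)(x)` for every `x ∉ Λ`. -/
theorem stmt_19 (Λ : Set (EuclideanSpace ℝ (Fin 3))) (hΛne : Λ.Nonempty)
    (hΛc : IsClosed Λ) (hΛ0 : volume Λ = 0)
    (w : EuclideanSpace ℝ (Fin 3) → ℝ) (hmeas : Measurable w)
    (hws : ContDiffOn ℝ (⊤ : ℕ∞) w Λᶜ)
    (hwL : Integrable (fun x : EuclideanSpace ℝ (Fin 3) =>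
      Real.exp (w x) / (1 + ‖x‖ ^ (4 : ℕ))) volume)
    (K q : ℝ) (hK : 0 < K) (hq : 0 < q)
    (hbound : ∀ y ∉ Λ,
      K⁻¹ * Metric.infDist y Λ ^ (-q) ≤ Real.exp (w y) ∧
        Real.exp (w y) ≤ K * Metric.infDist y Λ ^ (-q))
    (τ : ℝ) (hτ : 1 < τ)
    (hloc : ∀ s : Set (EuclideanSpace ℝ (Fin 3)), IsCompact s →
      IntegrableOn (fun y => Real.exp (w y) ^ τ) s volume) :
    ∀ x ∉ Λ,
      Real.exp (-w x) * halfLap (fun y => Real.exp (w y)) x ≤ halfLap w x := by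
  intro x hx
  have hcw : ContDiffAt ℝ 2 w x :=
    (hws.contDiffAt (hΛc.isOpen_compl.mem_nhds hx)).of_le (by norm_cast)
  have hIw := integrable_halfLap_integrand hmeas hcw
    (integrable_div_of_integrable_exp_div hΛne hΛc hΛ0 hmeas hwL hK hq fun y hy => (hbound y hy).1)
  have hIe := integrable_halfLap_integrand hmeas.exp hcw.exp hwL
  unfold halfLap
  rw [mul_neg, neg_le_neg_iff, ← integral_const_mul]
  refine integral_mono hIw (hIe.const_mul _) fun y => ?_
  have key : ∀ a, a - w x ≤ Real.exp (-w x) * Real.exp a - 1 := fun a => by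
    rw [← Real.exp_add]
    linarith [Real.add_one_le_exp (-w x + a)]
  have h1 : Real.exp (-w x) * Real.exp (w x) = 1 := by rw [← Real.exp_add]; simp
  simp only
  rw [← mul_div_assoc]
  gcongr
  linarith [key (w (x + y)), key (w (x - y))]
end
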